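/- Assume conditions (V) and (Q) with N < α ≤ β, and let 2 ≤ p < p̄, where p̄ := min{ 2(β−N)/(α−N), 2*_γ }. Let (u_n) be a sequence in C_c^∞(ℝ^N) with sup_n ‖u_n‖_{E_V^γ} < ∞ and such that ∫_{B_R} |u_n|^p dz → 0 as n → ∞ for every R > 0. Then ∫_{ℝ^N} Q(z)|u_n|^p dz → 0 as n → ∞. -/

import Mathlib

open MeasureTheory Filter

noncomputable section

/-- `ℝ^m` with its Euclidean structure. -/
abbrev Em (m : ℕ) : Type := EuclideanSpace ℝ (Fin m)

/-- Gradient in the `x`-variables. -/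
noncomputable def gradX {m k : ℕ} (u : Em m × Em k → ℝ) (z : Em m × Em k) : Em m :=
  gradient (fun x => u (x, z.2)) z.1

/-- Gradient in the `y`-variables. -/
noncomputable def gradY {m k : ℕ} (u : Em m × Em k → ℝ) (z : Em m × Em k) : Em k :=
  gradient (fun y => u (z.1, y)) z.2

/-- The Grushin gradient `∇_γ u (x,y) = (∇_x u, |x|^γ ∇_y u)`. -/
noncomputable def grushinGrad {m k : ℕ} (γ : ℝ) (u : Em m × Em k → ℝ) (z : Em m × Em k) :
    Em m × Em k :=
  (gradX u z, ‖z.1‖ ^ γ • gradY u z)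

/-- `|∇_γ u|² = |∇_x u|² + |x|^{2γ} |∇_y u|²`. -/
noncomputable def grushinSq {m k : ℕ} (γ : ℝ) (u : Em m × Em k → ℝ) (z : Em m × Em k) : ℝ :=
  ‖gradX u z‖ ^ 2 + ‖z.1‖ ^ (2 * γ) * ‖gradY u z‖ ^ 2

/-- The Euclidean norm of `z = (x,y) ∈ ℝ^m × ℝ^k ≅ ℝ^N`. -/
noncomputable def pnorm {m k : ℕ} (z : Em m × Em k) : ℝ :=
  Real.sqrt (‖z.1‖ ^ 2 + ‖z.2‖ ^ 2)

/-- The Euclidean ball `B_R = {z : |z| < R}` in `ℝ^m × ℝ^k ≅ ℝ^N`. -/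
def pball (m k : ℕ) (R : ℝ) : Set (Em m × Em k) := {z | pnorm z < R}

/-- The critical exponent `2*_γ = 2 N_γ / (N_γ - 2)`, `N_γ = m + (γ+1)k`. -/
noncomputable def twoStar (m k : ℕ) (γ : ℝ) : ℝ :=
  2 * ((m : ℝ) + (γ + 1) * k) / (((m : ℝ) + (γ + 1) * k) - 2)

/-- The norm of the space `E_V^γ`:
`‖u‖ = (∫ (|∇_γ u|² + V u²))^{1/2}` (with value `0` if the integral is infinite). -/
noncomputable def enormV {m k : ℕ} (γ : ℝ) (V u : Em m × Em k → ℝ) : ℝ :=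
  ((∫⁻ z, ENNReal.ofReal (grushinSq γ u z + V z * u z ^ 2)) ^ ((1:ℝ)/2)).toReal

/-- Differential in the `x`-variables. -/
def dX {m k : ℕ} (u : Em m × Em k → ℝ) (z : Em m × Em k) : Em m →L[ℝ] ℝ :=
  (fderiv ℝ u z).comp (ContinuousLinearMap.inl ℝ (Em m) (Em k))

/-- Differential in the `y`-variables. -/
def dY {m k : ℕ} (u : Em m × Em k → ℝ) (z : Em m × Em k) : Em k →L[ℝ] ℝ :=
  (fderiv ℝ u z).comp (ContinuousLinearMap.inr ℝ (Em m) (Em k))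

/-- The `ℓ¹` size `|∇_x u| + |x|^γ |∇_y u|` of the Grushin gradient. -/
def grushinAbs {m k : ℕ} (γ : ℝ) (u : Em m × Em k → ℝ) (z : Em m × Em k) : ENNReal :=
  ‖dX u z‖ₑ + ENNReal.ofReal (‖z.1‖ ^ γ) * ‖dY u z‖ₑ

instance isAddHaarMeasure_volume_prod (m k : ℕ) :
    (volume : Measure (Em m × Em k)).IsAddHaarMeasure := by
  rw [Measure.volume_eq_prod]; infer_instance

theorem norm_gradX {m k : ℕ} {u : Em m × Em k → ℝ} (hu : Differentiable ℝ u) (z : Em m × Em k) :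
    ‖gradX u z‖ = ‖dX u z‖ := by
  have h : HasFDerivAt (fun x => u (x, z.2)) (dX u z) z.1 :=
    (hu z).hasFDerivAt.comp z.1 (hasFDerivAt_prodMk_left z.1 z.2)
  rw [gradX, gradient, LinearIsometryEquiv.norm_map, h.fderiv]

theorem norm_gradY {m k : ℕ} {u : Em m × Em k → ℝ} (hu : Differentiable ℝ u) (z : Em m × Em k) :
    ‖gradY u z‖ = ‖dY u z‖ := by
  have h : HasFDerivAt (fun y => u (z.1, y)) (dY u z) z.2 :=
    (hu z).hasFDerivAt.comp z.2 (hasFDerivAt_prodMk_right z.1 z.2)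
  rw [gradY, gradient, LinearIsometryEquiv.norm_map, h.fderiv]

theorem continuous_dX {m k : ℕ} {u : Em m × Em k → ℝ} (hu : ContDiff ℝ 1 u) :
    Continuous (dX u) :=
  (hu.continuous_fderiv one_ne_zero).clm_comp continuous_const

theorem continuous_dY {m k : ℕ} {u : Em m × Em k → ℝ} (hu : ContDiff ℝ 1 u) :
    Continuous (dY u) :=
  (hu.continuous_fderiv one_ne_zero).clm_comp continuous_const

theorem measurable_grushinAbs {m k : ℕ} (γ : ℝ) {u : Em m × Em k → ℝ} (hu : ContDiff ℝ 1 u) :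
    Measurable (grushinAbs γ u) := by
  have h1 := (continuous_dX hu).measurable
  have h2 := (continuous_dY hu).measurable
  unfold grushinAbs
  fun_prop

theorem enorm_clm_add_le {E : Type*} [NormedAddCommGroup E] [NormedSpace ℝ E] (a b : E →L[ℝ] ℝ) :
    ‖a + b‖ₑ ≤ ‖a‖ₑ + ‖b‖ₑ := by
  rw [← ofReal_norm, ← ofReal_norm, ← ofReal_norm,
    ← ENNReal.ofReal_add (norm_nonneg _) (norm_nonneg _)]
  exact ENNReal.ofReal_le_ofReal (norm_add_le a b)

theorem enorm_fderiv_le {m k : ℕ} (u : Em m × Em k → ℝ) (z : Em m × Em k) :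
    ‖fderiv ℝ u z‖ₑ ≤ ‖dX u z‖ₑ + ‖dY u z‖ₑ := by
  have h : fderiv ℝ u z = (dX u z).comp (ContinuousLinearMap.fst ℝ (Em m) (Em k)) +
      (dY u z).comp (ContinuousLinearMap.snd ℝ (Em m) (Em k)) := by
    ext v <;> simp [dX, dY, ← Prod.zero_eq_mk]
  have h1 : ‖(dX u z).comp (ContinuousLinearMap.fst ℝ (Em m) (Em k))‖ ≤ ‖dX u z‖ :=
    (ContinuousLinearMap.opNorm_comp_le _ _).trans
      (mul_le_of_le_one_right (norm_nonneg _) (ContinuousLinearMap.norm_fst_le ..))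
  have h2 : ‖(dY u z).comp (ContinuousLinearMap.snd ℝ (Em m) (Em k))‖ ≤ ‖dY u z‖ :=
    (ContinuousLinearMap.opNorm_comp_le _ _).trans
      (mul_le_of_le_one_right (norm_nonneg _) (ContinuousLinearMap.norm_snd_le ..))
  rw [h]
  refine (enorm_clm_add_le _ _).trans (add_le_add ?_ ?_)
  · exact enorm_le_iff_norm_le.2 h1
  · exact enorm_le_iff_norm_le.2 h2

theorem enorm_le_lintegral_line {m k : ℕ} {f : Em m × Em k → ℝ} (hf : ContDiff ℝ 1 f)
    (hc : HasCompactSupport f) {e : Em m} (he : ‖e‖ = 1) (z : Em m × Em k) :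
    ‖f z‖ₑ ≤ ∫⁻ t : ℝ, ‖dX f (z + t • (e, 0))‖ₑ := by
  have he0 : ((e, 0) : Em m × Em k) ≠ 0 := by
    intro h
    have : e = 0 := congrArg Prod.fst h
    simp [this] at he
  have hg : ContDiff ℝ 1 (fun t : ℝ => f (z + t • (e, 0))) := by fun_prop
  have hgc : HasCompactSupport (fun t : ℝ => f (z + t • (e, 0))) :=
    hc.comp_isClosedEmbedding
      ((Homeomorph.addLeft z).isClosedEmbedding.comp (isClosedEmbedding_smul_left he0))
  have h := hgc.enorm_le_lintegral_Ici_deriv hg 0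
  simp only [zero_smul, add_zero] at h
  refine h.trans ((setLIntegral_le_lintegral _ _).trans (lintegral_mono fun t => ?_))
  have hd : HasDerivAt (fun t : ℝ => z + t • ((e, 0) : Em m × Em k)) (e, 0) t := by
    simpa using ((hasDerivAt_id t).smul_const ((e, 0) : Em m × Em k)).const_add z
  have hd' := ((hf.differentiable one_ne_zero) (z + t • (e, 0))).hasFDerivAt.comp_hasDerivAt t hd
  have hv : deriv (fun t : ℝ => f (z + t • (e, 0))) t = dX f (z + t • (e, 0)) e := hd'.deriv
  rw [hv]
  refine enorm_le_iff_norm_le.2 ?_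
  have := (dX f (z + t • (e, 0))).le_opNorm e
  rwa [he, mul_one] at this

theorem lintegral_slab_line_le {m k : ℕ} (i : Fin m) {h : Em m × Em k → ENNReal}
    (hh : Measurable h) :
    ∫⁻ z in {z : Em m × Em k | ‖z.1‖ ≤ 2},
      ∫⁻ t : ℝ, h (z + t • (EuclideanSpace.single i 1, 0)) ≤ 4 * ∫⁻ z, h z := by
  set e : Em m := EuclideanSpace.single i 1 with he_def
  set v : Em m × Em k := (e, 0) with hv_def
  set S : Set (Em m × Em k) := {z | ‖z.1‖ ≤ 2} with hS_def
  have hS : MeasurableSet S := measurableSet_le (by fun_prop) measurable_const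
  set g : Em m × Em k → ENNReal := S.indicator 1 with hg_def
  have hg : Measurable g := measurable_one.indicator hS
  have hslice : ∀ w : Em m × Em k, ∫⁻ t : ℝ, g (w - t • v) ≤ 4 := by
    intro w
    calc ∫⁻ t : ℝ, g (w - t • v)
        ≤ ∫⁻ t : ℝ, (Set.Icc (w.1 i - 2) (w.1 i + 2)).indicator 1 t := by
          refine lintegral_mono fun t => ?_
          by_cases ht : w - t • v ∈ S
          · have h1 : ‖w.1 - t • e‖ ≤ 2 := ht
            have h2 := (PiLp.norm_apply_le (w.1 - t • e) i).trans h1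
            have h3 : |w.1 i - t| ≤ 2 := by simpa [he_def] using h2
            rw [abs_le] at h3
            have : t ∈ Set.Icc (w.1 i - 2) (w.1 i + 2) := ⟨by linarith, by linarith⟩
            rw [hg_def, Set.indicator_of_mem ht, Set.indicator_of_mem this]
            exact le_rfl
          · rw [hg_def, Set.indicator_of_notMem ht]; exact zero_le
      _ = 4 := by
          rw [lintegral_indicator_one measurableSet_Icc, Real.volume_Icc]
          ring_nf; simp
  have hadd : Measurable fun q : (Em m × Em k) × ℝ => q.1 + q.2 • v := by fun_prop
  have hsub : Measurable fun q : ℝ × (Em m × Em k) => q.2 - q.1 • v := by fun_prop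
  calc ∫⁻ z in S, ∫⁻ t : ℝ, h (z + t • v)
      = ∫⁻ z, ∫⁻ t : ℝ, g z * h (z + t • v) := by
        rw [← lintegral_indicator hS]
        refine lintegral_congr fun z => ?_
        have hz' : Measurable fun t : ℝ => h (z + t • v) := hh.comp (by fun_prop)
        rw [lintegral_const_mul _ hz']
        by_cases hz : z ∈ S <;> simp [hg_def, hz]
    _ = ∫⁻ t : ℝ, ∫⁻ z, g z * h (z + t • v) :=
        lintegral_lintegral_swap ((hg.comp measurable_fst).mul (hh.comp hadd)).aemeasurable
    _ = ∫⁻ t : ℝ, ∫⁻ w, g (w - t • v) * h w := by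
        refine lintegral_congr fun t => ?_
        rw [← lintegral_add_right_eq_self (fun w => g (w - t • v) * h w) (t • v)]
        simp only [add_sub_cancel_right]
    _ = ∫⁻ w, ∫⁻ t : ℝ, g (w - t • v) * h w :=
        lintegral_lintegral_swap ((hg.comp hsub).mul (hh.comp measurable_snd)).aemeasurable
    _ ≤ ∫⁻ w, 4 * h w := by
        refine lintegral_mono fun w => ?_
        have hw' : Measurable fun t : ℝ => g (w - t • v) := hg.comp (by fun_prop)
        rw [lintegral_mul_const _ hw']
        exact mul_le_mul_left (hslice w) _
    _ = 4 * ∫⁻ z, h z := lintegral_const_mul _ hh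

theorem lintegral_slab_le {m k : ℕ} (hm : 1 ≤ m) {f : Em m × Em k → ℝ} (hf : ContDiff ℝ 1 f)
    (hc : HasCompactSupport f) :
    ∫⁻ z in {z : Em m × Em k | ‖z.1‖ ≤ 2}, ‖f z‖ₑ ≤ 4 * ∫⁻ z, ‖dX f z‖ₑ :=
  (lintegral_mono fun z => enorm_le_lintegral_line hf hc (by simp) z).trans
    (lintegral_slab_line_le ⟨0, hm⟩ (continuous_dX hf).measurable.enorm)

theorem exists_cutoff (E : Type*) [NormedAddCommGroup E] [InnerProductSpace ℝ E]
    [FiniteDimensional ℝ E] :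
    ∃ (φ : E → ℝ) (K : NNReal), ContDiff ℝ (⊤ : ℕ∞) φ ∧ (∀ x, ‖x‖ ≤ 1 → φ x = 0) ∧
      (∀ x, 2 ≤ ‖x‖ → φ x = 1) ∧ (∀ x, |φ x| ≤ 1) ∧ (∀ x, ‖fderiv ℝ φ x‖ ≤ K) ∧
      (∀ x, ‖x‖ < 1 → fderiv ℝ φ x = 0) ∧ (∀ x, 2 < ‖x‖ → fderiv ℝ φ x = 0) := by
  set φ : E → ℝ := fun x => Real.smoothTransition (‖x‖ ^ 2 - 1) with hφ
  have hsm : ContDiff ℝ (⊤ : ℕ∞) φ :=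
    Real.smoothTransition.contDiff.comp ((contDiff_norm_sq ℝ).sub contDiff_const)
  have h0 : ∀ x, ‖x‖ ≤ 1 → φ x = 0 := fun x hx =>
    Real.smoothTransition.zero_of_nonpos (by nlinarith [norm_nonneg x])
  have h1 : ∀ x, 2 ≤ ‖x‖ → φ x = 1 := fun x hx =>
    Real.smoothTransition.one_of_one_le (by nlinarith [norm_nonneg x])
  have hd0 : ∀ x, ‖x‖ < 1 → fderiv ℝ φ x = 0 := by
    intro x hx
    have : φ =ᶠ[nhds x] fun _ => 0 := by
      filter_upwards [continuous_norm.continuousAt.eventually_lt continuousAt_const hx] with y hy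
      exact h0 y hy.le
    rw [this.fderiv_eq]; simp
  have hd1 : ∀ x, 2 < ‖x‖ → fderiv ℝ φ x = 0 := by
    intro x hx
    have : φ =ᶠ[nhds x] fun _ => 1 := by
      filter_upwards [continuousAt_const.eventually_lt continuous_norm.continuousAt hx] with y hy
      exact h1 y hy.le
    rw [this.fderiv_eq]; simp
  obtain ⟨K, hK⟩ := (isCompact_closedBall (0 : E) 2).exists_bound_of_continuousOn
    (hsm.continuous_fderiv (by simp)).continuousOn
  refine ⟨φ, K.toNNReal, hsm, h0, h1, fun x => ?_, fun x => ?_, hd0, hd1⟩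
  · rw [abs_of_nonneg (Real.smoothTransition.nonneg _)]
    exact Real.smoothTransition.le_one _
  · rcases lt_or_ge 2 ‖x‖ with hx | hx
    · rw [hd1 x hx, norm_zero]; positivity
    · exact (hK x (by simpa using hx)).trans (Real.le_coe_toNNReal K)

theorem exists_measure_superlevel_le_add {m k : ℕ} (hm : 1 ≤ m) {γ : ℝ}
    (hγ : 0 ≤ γ) {p : ℝ} (hp : Real.HolderConjugate ((m : ℝ) + k) p) :
    ∃ C : NNReal, ∀ f : Em m × Em k → ℝ, ContDiff ℝ 1 f → HasCompactSupport f →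
      volume {z | 1 ≤ ‖f z‖ₑ} ≤
        C * ((∫⁻ z, grushinAbs γ f z) + (∫⁻ z, grushinAbs γ f z) ^ p) := by
  obtain ⟨η, K, hη, hη0, hη1, hηle, hηK, -, hηd⟩ := exists_cutoff (Em m)
  set A := lintegralPowLePowLIntegralFDerivConst (volume : Measure (Em m × Em k)) p
  have hp0 : 0 < p := hp.symm.pos
  refine ⟨4 + A * (4 * K + 1) ^ p, fun f hf hc => ?_⟩
  set P := ∫⁻ z, grushinAbs γ f z with hP
  set S : Set (Em m × Em k) := {z | ‖z.1‖ ≤ 2} with hS_def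
  have hS : MeasurableSet S := measurableSet_le (by fun_prop) measurable_const
  have hslab : ∫⁻ z in S, ‖f z‖ₑ ≤ 4 * P :=
    (lintegral_slab_le hm hf hc).trans
      (mul_le_mul_right (lintegral_mono fun z => le_self_add) _)
  set g : Em m × Em k → ℝ := fun z => η z.1 * f z with hg_def
  have hη' : ContDiff ℝ 1 fun z : Em m × Em k => η z.1 :=
    (hη.of_le (by exact_mod_cast le_top)).comp contDiff_fst
  have hg : ContDiff ℝ 1 g := hη'.mul hf
  have hgc : HasCompactSupport g := hc.mul_left
  have hfin : ((Module.finrank ℝ (Em m × Em k) : ℕ) : ℝ).HolderConjugate p := by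
    simpa using hp
  have hgns := lintegral_pow_le_pow_lintegral_fderiv
    (volume : Measure (Em m × Em k)) hg hgc hfin
  have hgd : ∀ z, ‖fderiv ℝ g z‖ₑ ≤ K * S.indicator (fun z => ‖f z‖ₑ) z + grushinAbs γ f z := by
    intro z
    have hηz : HasFDerivAt (fun z : Em m × Em k => η z.1)
        ((fderiv ℝ η z.1).comp (ContinuousLinearMap.fst ℝ (Em m) (Em k))) z :=
      ((hη.differentiable (by simp)) z.1).hasFDerivAt.comp z hasFDerivAt_fst
    have hfz := ((hf.differentiable one_ne_zero) z).hasFDerivAt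
    have hgz : fderiv ℝ g z = η z.1 • fderiv ℝ f z +
        f z • (fderiv ℝ η z.1).comp (ContinuousLinearMap.fst ℝ (Em m) (Em k)) :=
      (hηz.mul hfz).fderiv
    rw [hgz, add_comm]
    refine (enorm_clm_add_le _ _).trans (add_le_add ?_ ?_)
    · rw [enorm_smul, mul_comm]
      by_cases hz : z ∈ S
      · rw [Set.indicator_of_mem hz]
        refine mul_le_mul_left ?_ _
        rw [← ofReal_norm, ← ENNReal.ofReal_coe_nnreal]
        refine ENNReal.ofReal_le_ofReal ?_
        refine (ContinuousLinearMap.opNorm_comp_le _ _).trans ?_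
        refine (mul_le_of_le_one_right (norm_nonneg _)
          (ContinuousLinearMap.norm_fst_le ..)).trans ?_
        exact hηK z.1
      · have : 2 < ‖z.1‖ := by simpa [hS_def] using hz
        rw [hηd z.1 this, ContinuousLinearMap.zero_comp, ← ofReal_norm, norm_zero]
        simp
    · rw [enorm_smul]
      rcases le_total ‖z.1‖ 1 with hz | hz
      · simp [hη0 z.1 hz]
      · have h1 : ‖η z.1‖ₑ ≤ 1 := by
          rw [← enorm_one (G := ℝ), enorm_le_iff_norm_le]; simpa using hηle z.1
        have h2 : 1 ≤ ENNReal.ofReal (‖z.1‖ ^ γ) := by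
          rw [← ENNReal.ofReal_one]
          exact ENNReal.ofReal_le_ofReal (Real.one_le_rpow hz hγ)
        calc ‖η z.1‖ₑ * ‖fderiv ℝ f z‖ₑ ≤ 1 * (‖dX f z‖ₑ + ‖dY f z‖ₑ) :=
              mul_le_mul' h1 (enorm_fderiv_le f z)
          _ ≤ grushinAbs γ f z := by
              rw [one_mul, grushinAbs]
              exact add_le_add le_rfl (le_mul_of_one_le_left zero_le h2)
  have hgd' : ∫⁻ z, ‖fderiv ℝ g z‖ₑ ≤ (4 * K + 1) * P := by
    refine (lintegral_mono hgd).trans ?_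
    have hfm : Measurable fun z => ‖f z‖ₑ := hf.continuous.measurable.enorm
    rw [lintegral_add_right _ (measurable_grushinAbs γ hf),
      lintegral_const_mul _ (hfm.indicator hS), lintegral_indicator hS, add_mul, one_mul]
    refine add_le_add ?_ le_rfl
    calc (K : ENNReal) * ∫⁻ z in S, ‖f z‖ₑ ≤ K * (4 * P) := mul_le_mul_right hslab _
      _ = 4 * K * P := by ring
  have hnear : volume ({z | 1 ≤ ‖f z‖ₑ} ∩ S) ≤ 4 * P := by
    have h := mul_meas_ge_le_lintegral (μ := volume.restrict S)
      (f := fun z => ‖f z‖ₑ) hf.continuous.measurable.enorm 1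
    rw [one_mul, Measure.restrict_apply' hS] at h
    exact h.trans hslab
  have hfar : volume ({z | 1 ≤ ‖f z‖ₑ} \ S) ≤ A * ((4 * K + 1) * P) ^ p := by
    have h := mul_meas_ge_le_lintegral (μ := (volume : Measure (Em m × Em k)))
      (f := fun z => ‖g z‖ₑ ^ p) (hg.continuous.measurable.enorm.pow_const p) 1
    rw [one_mul] at h
    refine (measure_mono ?_).trans (h.trans (hgns.trans ?_))
    · rintro z ⟨hz, hzS⟩
      have hz2 : 2 < ‖z.1‖ := by simpa [hS_def] using hzS
      have : g z = f z := by simp [hg_def, hη1 z.1 hz2.le]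
      simp only [Set.mem_ofPred_eq, this] at hz ⊢
      exact ENNReal.one_le_rpow hz hp0
    · exact mul_le_mul_right (ENNReal.rpow_le_rpow hgd' hp0.le) _
  calc volume {z | 1 ≤ ‖f z‖ₑ} ≤ 4 * P + A * ((4 * K + 1) * P) ^ p :=
        (measure_le_inter_add_sdiff _ _ S).trans (add_le_add hnear hfar)
    _ = 4 * P + A * (4 * K + 1) ^ p * P ^ p := by
        rw [ENNReal.mul_rpow_of_nonneg _ _ hp0.le, mul_assoc]
    _ ≤ (4 + A * (4 * K + 1) ^ p) * P + (4 + A * (4 * K + 1) ^ p) * P ^ p := by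
        gcongr
        · exact le_self_add
        · exact le_add_self
    _ = _ := by
        rw [← mul_add]
        push_cast [ENNReal.coe_rpow_of_nonneg _ hp0.le]
        rfl

/-- The anisotropic dilation `(x, y) ↦ (ρ x, ρ^{1+γ} y)`. -/
def grushinDil (m k : ℕ) (γ ρ : ℝ) : Em m × Em k →L[ℝ] Em m × Em k :=
  (ρ • ContinuousLinearMap.id ℝ (Em m)).prodMap (ρ ^ (1 + γ) • ContinuousLinearMap.id ℝ (Em k))

theorem grushinDil_apply {m k : ℕ} (γ ρ : ℝ) (z : Em m × Em k) :
    grushinDil m k γ ρ z = (ρ • z.1, ρ ^ (1 + γ) • z.2) := rfl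

theorem lintegral_comp_grushinDil {m k : ℕ} (γ : ℝ) {ρ : ℝ} (hρ : 0 < ρ)
    {h : Em m × Em k → ENNReal} (hh : Measurable h) :
    ∫⁻ z, h (grushinDil m k γ ρ z) =
      ENNReal.ofReal (ρ ^ (-((m : ℝ) + (γ + 1) * k))) * ∫⁻ z, h z := by
  have hc : 0 < ρ ^ (1 + γ) := Real.rpow_pos_of_pos hρ _
  have hmap : Measure.map (grushinDil m k γ ρ) (volume : Measure (Em m × Em k)) =
      ENNReal.ofReal (ρ ^ (-((m : ℝ) + (γ + 1) * k))) • volume := by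
    have h1 : (grushinDil m k γ ρ : Em m × Em k → Em m × Em k) =
        Prod.map (fun x => ρ • x) (fun y => ρ ^ (1 + γ) • y) := rfl
    rw [h1, Measure.volume_eq_prod, ← Measure.map_prod_map _ _ (by fun_prop) (by fun_prop),
      Measure.map_addHaar_smul _ hρ.ne', Measure.map_addHaar_smul _ hc.ne',
      Measure.prod_smul_left, Measure.prod_smul_right, smul_smul,
      ← ENNReal.ofReal_mul (abs_nonneg _)]
    congr 2
    rw [abs_of_pos (by positivity), abs_of_pos (by positivity)]
    simp only [finrank_euclideanSpace, Fintype.card_fin]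
    rw [← mul_inv, Real.rpow_neg hρ.le, Real.rpow_add hρ (m : ℝ), Real.rpow_natCast, add_comm γ 1,
      Real.rpow_mul hρ.le, Real.rpow_natCast]
  rw [← lintegral_map hh (grushinDil m k γ ρ).continuous.measurable, hmap, lintegral_smul_measure,
    smul_eq_mul]

theorem grushinAbs_comp_grushinDil {m k : ℕ} (γ : ℝ) {ρ : ℝ} (hρ : 0 < ρ)
    {f : Em m × Em k → ℝ} (hf : Differentiable ℝ f) (z : Em m × Em k) :
    grushinAbs γ (f ∘ grushinDil m k γ ρ) z =
      ENNReal.ofReal ρ * grushinAbs γ f (grushinDil m k γ ρ z) := by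
  have hd : fderiv ℝ (f ∘ grushinDil m k γ ρ) z =
      (fderiv ℝ f (grushinDil m k γ ρ z)).comp (grushinDil m k γ ρ) :=
    ((hf _).hasFDerivAt.comp z (grushinDil m k γ ρ).hasFDerivAt).fderiv
  have hx : dX (f ∘ grushinDil m k γ ρ) z = ρ • dX f (grushinDil m k γ ρ z) := by
    ext v
    have : ((ρ • v, (0 : Em k)) : Em m × Em k) = ρ • (v, 0) := by simp
    simp only [dX, hd, ContinuousLinearMap.comp_apply, ContinuousLinearMap.inl_apply,
      grushinDil_apply (m := m) (k := k) γ ρ (v, 0), smul_zero, this, map_smul,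
      smul_apply]
  have hy : dY (f ∘ grushinDil m k γ ρ) z = ρ ^ (1 + γ) • dY f (grushinDil m k γ ρ z) := by
    ext v
    have : (((0 : Em m), ρ ^ (1 + γ) • v) : Em m × Em k) = ρ ^ (1 + γ) • (0, v) := by simp
    simp only [dY, hd, ContinuousLinearMap.comp_apply, ContinuousLinearMap.inr_apply,
      grushinDil_apply (m := m) (k := k) γ ρ (0, v), smul_zero, this, map_smul,
      smul_apply]
  have hn : ‖(grushinDil m k γ ρ z).1‖ ^ γ = ρ ^ γ * ‖z.1‖ ^ γ := by
    rw [grushinDil_apply, norm_smul, Real.norm_of_nonneg hρ.le,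
      Real.mul_rpow hρ.le (norm_nonneg _)]
  have hργ : 0 ≤ ρ ^ γ := (Real.rpow_pos_of_pos hρ _).le
  have hρe : ∀ c : ℝ, 0 ≤ c → ‖c‖ₑ = ENNReal.ofReal c := fun c hc => Real.enorm_of_nonneg hc
  rw [grushinAbs, grushinAbs, hx, hy, hn, enorm_smul, enorm_smul, hρe _ hρ.le,
    hρe _ (Real.rpow_pos_of_pos hρ _).le, Real.rpow_add hρ, Real.rpow_one,
    ENNReal.ofReal_mul hργ, ENNReal.ofReal_mul hρ.le]
  ring

theorem exists_measure_superlevel_le {m k : ℕ} (hm : 1 ≤ m) (hN : 2 ≤ m + k) {γ : ℝ}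
    (hγ : 0 ≤ γ) :
    ∃ C : NNReal, ∀ f : Em m × Em k → ℝ, ContDiff ℝ 1 f → HasCompactSupport f →
      volume {z | 1 ≤ ‖f z‖ₑ} ≤ C * (∫⁻ z, grushinAbs γ f z) ^
        (((m : ℝ) + (γ + 1) * k) / ((m : ℝ) + (γ + 1) * k - 1)) := by
  have hN' : (2 : ℝ) ≤ (m : ℝ) + k := by exact_mod_cast hN
  set D : ℝ := (m : ℝ) + (γ + 1) * k with hD
  have hD1 : 1 < D := by
    have : 0 ≤ γ * k := by positivity
    rw [hD]; linarith
  have hp := Real.HolderConjugate.conjExponent (show 1 < (m : ℝ) + k by linarith)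
  set p := Real.conjExponent ((m : ℝ) + k)
  obtain ⟨C, hC⟩ := exists_measure_superlevel_le_add (γ := γ) hm hγ hp
  have hp0 : 0 < p := hp.symm.pos
  have hs : 0 < D / (D - 1) := div_pos (by linarith) (by linarith)
  refine ⟨2 * C + 1, fun f hf hc => ?_⟩
  set P := ∫⁻ z, grushinAbs γ f z with hP
  rcases eq_or_ne P 0 with hP0 | hP0
  · have := hC f hf hc
    rw [← hP, hP0, ENNReal.zero_rpow_of_pos hp0] at this
    exact (this.trans (by simp)).trans zero_le
  rcases eq_or_ne P ⊤ with hPt | hPt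
  · rw [hPt, ENNReal.top_rpow_of_pos hs, ENNReal.mul_top (by simp)]
    exact le_top
  have hPr : 0 < P.toReal := ENNReal.toReal_pos hP0 hPt
  set ρ : ℝ := P.toReal ^ (1 / (D - 1)) with hρ_def
  have hρ : 0 < ρ := Real.rpow_pos_of_pos hPr _
  have hfm : Measurable fun z => ‖f z‖ₑ := hf.continuous.measurable.enorm
  have hA : MeasurableSet {z | 1 ≤ ‖f z‖ₑ} := measurableSet_le measurable_const hfm
  have hdc : HasCompactSupport (f ∘ grushinDil m k γ ρ) := by
    have hc' : ρ ^ (1 + γ) ≠ 0 := (Real.rpow_pos_of_pos hρ _).ne'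
    exact hc.comp_homeomorph ((Homeomorph.smulOfNeZero ρ hρ.ne').prodCongr
      (Homeomorph.smulOfNeZero (ρ ^ (1 + γ)) hc'))
  have h := hC (f ∘ grushinDil m k γ ρ) (hf.comp (grushinDil m k γ ρ).contDiff) hdc
  have hPρ : ∫⁻ z, grushinAbs γ (f ∘ grushinDil m k γ ρ) z = 1 := by
    simp_rw [grushinAbs_comp_grushinDil γ hρ (hf.differentiable one_ne_zero)]
    have hgm := measurable_grushinAbs γ hf
    have hgm' : Measurable fun z => grushinAbs γ f (grushinDil m k γ ρ z) :=
      hgm.comp (grushinDil m k γ ρ).continuous.measurable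
    rw [lintegral_const_mul _ hgm',
      lintegral_comp_grushinDil γ hρ hgm, ← hP, ← ENNReal.ofReal_toReal hPt, ← mul_assoc,
      ← ENNReal.ofReal_mul hρ.le, ← ENNReal.ofReal_mul (by positivity), ← ENNReal.ofReal_one]
    congr 1
    nth_rewrite 1 [← Real.rpow_one ρ]
    rw [← Real.rpow_add hρ, hρ_def, ← Real.rpow_mul hPr.le, ← Real.rpow_add_one hPr.ne']
    have : 1 / (D - 1) * (1 + -((m : ℝ) + (γ + 1) * k)) + 1 = 0 := by
      rw [← hD]; field_simp [show D - 1 ≠ 0 by linarith]; ring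
    rw [this, Real.rpow_zero]
  have hV : volume {z | 1 ≤ ‖(f ∘ grushinDil m k γ ρ) z‖ₑ} =
      ENNReal.ofReal (ρ ^ (-D)) * volume {z | 1 ≤ ‖f z‖ₑ} := by
    have h1 := lintegral_comp_grushinDil (m := m) (k := k) γ hρ
      (h := {z | 1 ≤ ‖f z‖ₑ}.indicator 1) (measurable_one.indicator hA)
    rw [lintegral_indicator_one hA] at h1
    rw [← h1]
    exact (lintegral_indicator_one
      (hA.preimage (grushinDil m k γ ρ).continuous.measurable)).symm
  rw [hPρ, ENNReal.one_rpow, hV] at h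
  calc volume {z | 1 ≤ ‖f z‖ₑ}
      = ENNReal.ofReal (ρ ^ D) * (ENNReal.ofReal (ρ ^ (-D)) * volume {z | 1 ≤ ‖f z‖ₑ}) := by
        rw [← mul_assoc, ← ENNReal.ofReal_mul (by positivity), ← Real.rpow_add hρ]
        simp
    _ ≤ ENNReal.ofReal (ρ ^ D) * (C * (1 + 1)) := mul_le_mul_right h _
    _ = 2 * C * P ^ (D / (D - 1)) := by
        have : ENNReal.ofReal (ρ ^ D) = P ^ (D / (D - 1)) := by
          rw [hρ_def, ← Real.rpow_mul hPr.le, ← ENNReal.ofReal_rpow_of_pos hPr,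
            ENNReal.ofReal_toReal hPt]
          congr 1; field_simp
        rw [this]; ring
    _ ≤ _ := by
        refine mul_le_mul_left ?_ _
        push_cast
        exact le_self_add

theorem grushinAbs_le {m k : ℕ} (γ : ℝ) {u : Em m × Em k → ℝ} (hu : Differentiable ℝ u)
    (z : Em m × Em k) :
    grushinAbs γ u z ≤ 2 * ENNReal.ofReal (grushinSq γ u z) ^ ((1 : ℝ) / 2) := by
  have hw : 0 ≤ ‖z.1‖ ^ γ := Real.rpow_nonneg (norm_nonneg _) _
  have hsq : grushinSq γ u z = ‖dX u z‖ ^ 2 + (‖z.1‖ ^ γ * ‖dY u z‖) ^ 2 := by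
    rw [grushinSq, norm_gradX hu, norm_gradY hu, mul_pow, ← Real.rpow_natCast (‖z.1‖ ^ γ) 2,
      ← Real.rpow_mul (norm_nonneg _)]
    norm_num [mul_comm]
  have h0 : 0 ≤ grushinSq γ u z := by rw [hsq]; positivity
  rw [grushinAbs, ENNReal.ofReal_rpow_of_nonneg h0 (by norm_num), ← Real.sqrt_eq_rpow,
    ← ofReal_norm, ← ofReal_norm, ← ENNReal.ofReal_mul hw,
    ← ENNReal.ofReal_add (norm_nonneg _) (by positivity),
    two_mul, ← ENNReal.ofReal_add (Real.sqrt_nonneg _) (Real.sqrt_nonneg _)]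
  refine ENNReal.ofReal_le_ofReal ?_
  have h1 : ‖dX u z‖ ≤ Real.sqrt (grushinSq γ u z) :=
    Real.le_sqrt_of_sq_le (by rw [hsq]; nlinarith [sq_nonneg (‖z.1‖ ^ γ * ‖dY u z‖)])
  have h2 : ‖z.1‖ ^ γ * ‖dY u z‖ ≤ Real.sqrt (grushinSq γ u z) :=
    Real.le_sqrt_of_sq_le (by rw [hsq]; nlinarith [sq_nonneg ‖dX u z‖])
  linarith

theorem measurable_grushinSq {m k : ℕ} (γ : ℝ) {u : Em m × Em k → ℝ} (hu : ContDiff ℝ 1 u) :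
    Measurable (grushinSq γ u) := by
  have hd := hu.differentiable one_ne_zero
  have h1 : Measurable fun z => ‖dX u z‖ := (continuous_dX hu).measurable.norm
  have h2 : Measurable fun z => ‖dY u z‖ := (continuous_dY hu).measurable.norm
  unfold grushinSq
  simp_rw [norm_gradX hd, norm_gradY hd]
  fun_prop

theorem setLIntegral_grushinAbs_le {m k : ℕ} (γ : ℝ) {u : Em m × Em k → ℝ}
    (hu : ContDiff ℝ 1 u) {A : Set (Em m × Em k)} (hA : MeasurableSet A) :
    ∫⁻ z in A, grushinAbs γ u z ≤
      2 * ((∫⁻ z, ENNReal.ofReal (grushinSq γ u z)) ^ ((1 : ℝ) / 2) *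
        volume A ^ ((1 : ℝ) / 2)) := by
  have hm := (measurable_grushinSq γ hu).ennreal_ofReal
  have hcs := ENNReal.lintegral_mul_le_Lp_mul_Lq (volume : Measure (Em m × Em k))
    Real.HolderConjugate.two_two
    (f := fun z => ENNReal.ofReal (grushinSq γ u z) ^ ((1 : ℝ) / 2)) (g := A.indicator 1)
    (hm.pow_const _).aemeasurable (measurable_one.indicator hA).aemeasurable
  have hgm : Measurable fun z => ENNReal.ofReal (grushinSq γ u z) ^ ((1 : ℝ) / 2) *
      A.indicator (1 : Em m × Em k → ENNReal) z :=
    (hm.pow_const _).mul (measurable_one.indicator hA)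
  have h1 : ∀ z, (ENNReal.ofReal (grushinSq γ u z) ^ ((1 : ℝ) / 2)) ^ (2 : ℝ) =
      ENNReal.ofReal (grushinSq γ u z) := fun z => by
    rw [← ENNReal.rpow_mul]; norm_num
  have h2 : ∀ z, (A.indicator (1 : Em m × Em k → ENNReal) z) ^ (2 : ℝ) = A.indicator 1 z :=
    fun z => by by_cases hz : z ∈ A <;> simp [hz]
  simp_rw [h1, h2, lintegral_indicator_one hA] at hcs
  rw [← lintegral_indicator hA]
  calc ∫⁻ z, A.indicator (grushinAbs γ u) z
      ≤ ∫⁻ z, 2 * (ENNReal.ofReal (grushinSq γ u z) ^ ((1 : ℝ) / 2) * A.indicator 1 z) := by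
        refine lintegral_mono fun z => ?_
        by_cases hz : z ∈ A
        · simpa [hz] using grushinAbs_le γ (hu.differentiable one_ne_zero) z
        · simp [hz]
    _ ≤ _ := by
        rw [lintegral_const_mul _ hgm]
        exact mul_le_mul_right hcs _

theorem exists_measure_superlevel_two_mul_le {m k : ℕ} (hm : 1 ≤ m) (hN : 2 ≤ m + k) {γ : ℝ}
    (hγ : 0 ≤ γ) :
    ∃ C : NNReal, ∀ u : Em m × Em k → ℝ, ContDiff ℝ (⊤ : ℕ∞) u → HasCompactSupport u →
      ∀ t : ℝ, 0 < t → volume {z | 2 * t ≤ |u z|} ≤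
        C * (ENNReal.ofReal t⁻¹ * ((∫⁻ z, ENNReal.ofReal (grushinSq γ u z)) ^ ((1 : ℝ) / 2) *
          volume {z | t ≤ |u z|} ^ ((1 : ℝ) / 2))) ^
        (((m : ℝ) + (γ + 1) * k) / ((m : ℝ) + (γ + 1) * k - 1)) := by
  obtain ⟨C, hC⟩ := exists_measure_superlevel_le (γ := γ) hm hN hγ
  obtain ⟨φ, K, hφ, hφ0, hφ1, -, hφK, hφd, -⟩ := exists_cutoff ℝ
  set s : ℝ := ((m : ℝ) + (γ + 1) * k) / ((m : ℝ) + (γ + 1) * k - 1) with hs_def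
  have hs : 0 ≤ s := by
    have hN' : (2 : ℝ) ≤ (m : ℝ) + k := by exact_mod_cast hN
    have : 0 ≤ γ * k := by positivity
    exact div_nonneg (by linarith) (by linarith)
  refine ⟨C * (2 * K) ^ s, fun u hu hc t ht => ?_⟩
  have hu1 : ContDiff ℝ 1 u := hu.of_le (by exact_mod_cast le_top)
  have hud := hu1.differentiable one_ne_zero
  set f : Em m × Em k → ℝ := fun z => φ (t⁻¹ * u z) with hf_def
  have hf : ContDiff ℝ 1 f :=
    (hφ.of_le (by exact_mod_cast le_top)).comp (contDiff_const.mul hu1)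
  have hfc : HasCompactSupport f :=
    hc.comp_left (g := fun y => φ (t⁻¹ * y)) (hφ0 _ (by simp))
  set A : Set (Em m × Em k) := {z | t ≤ |u z|} with hA_def
  have hA : MeasurableSet A := measurableSet_le measurable_const hu.continuous.abs.measurable
  have hfd : ∀ z, fderiv ℝ f z = (deriv φ (t⁻¹ * u z) * t⁻¹) • fderiv ℝ u z := by
    intro z
    have h1 := ((hφ.differentiable (by simp)) (t⁻¹ * u z)).hasDerivAt
    have h2 := (hud z).hasFDerivAt.const_mul t⁻¹
    rw [mul_smul]
    exact (h1.comp_hasFDerivAt z h2).fderiv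
  have habs : ∀ z, grushinAbs γ f z ≤
      (K * ENNReal.ofReal t⁻¹) * A.indicator (grushinAbs γ u) z := by
    intro z
    have hx : dX f z = (deriv φ (t⁻¹ * u z) * t⁻¹) • dX u z := by
      rw [dX, hfd, ContinuousLinearMap.smul_comp]; rfl
    have hy : dY f z = (deriv φ (t⁻¹ * u z) * t⁻¹) • dY u z := by
      rw [dY, hfd, ContinuousLinearMap.smul_comp]; rfl
    have heq : grushinAbs γ f z = ‖deriv φ (t⁻¹ * u z) * t⁻¹‖ₑ * grushinAbs γ u z := by
      rw [grushinAbs, grushinAbs, hx, hy, enorm_smul, enorm_smul]; ring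
    rw [heq]
    by_cases hz : z ∈ A
    · rw [Set.indicator_of_mem hz]
      refine mul_le_mul_left ?_ _
      rw [enorm_mul, Real.enorm_of_nonneg (inv_pos.2 ht).le]
      refine mul_le_mul_left ?_ _
      rw [← ofReal_norm, ← ENNReal.ofReal_coe_nnreal]
      refine ENNReal.ofReal_le_ofReal ?_
      rw [norm_deriv_eq_norm_fderiv]
      exact hφK _
    · have hz' : |u z| < t := by simpa [hA_def] using hz
      have h1 : ‖t⁻¹ * u z‖ < 1 := by
        rw [Real.norm_eq_abs, abs_mul, abs_of_pos (inv_pos.2 ht), inv_mul_lt_one₀ ht]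
        exact hz'
      have h2 : deriv φ (t⁻¹ * u z) = 0 := by
        rw [← norm_eq_zero, norm_deriv_eq_norm_fderiv, hφd _ h1, norm_zero]
      simp [h2]
  have hint : ∫⁻ z, grushinAbs γ f z ≤ (2 * K) * (ENNReal.ofReal t⁻¹ *
      ((∫⁻ z, ENNReal.ofReal (grushinSq γ u z)) ^ ((1 : ℝ) / 2) * volume A ^ ((1 : ℝ) / 2))) := by
    refine (lintegral_mono habs).trans ?_
    rw [lintegral_const_mul _ ((measurable_grushinAbs γ hu1).indicator hA),
      lintegral_indicator hA]
    refine (mul_le_mul_right (setLIntegral_grushinAbs_le γ hu1 hA) _).trans_eq ?_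
    ring
  have hsub : {z | 2 * t ≤ |u z|} ⊆ {z | 1 ≤ ‖f z‖ₑ} := by
    intro z hz
    have h1 : 2 ≤ ‖t⁻¹ * u z‖ := by
      rw [Real.norm_eq_abs, abs_mul, abs_of_pos (inv_pos.2 ht), inv_mul_eq_div, le_div_iff₀ ht]
      exact hz
    have h2 : f z = 1 := hφ1 _ h1
    simp [h2]
  refine (measure_mono hsub).trans ((hC f hf hfc).trans ?_)
  refine (mul_le_mul_right (ENNReal.rpow_le_rpow hint hs) _).trans_eq ?_
  rw [ENNReal.mul_rpow_of_nonneg _ _ hs]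
  push_cast [ENNReal.coe_rpow_of_nonneg _ hs]
  rw [mul_assoc]

theorem ENNReal.le_rpow_of_le_mul_rpow {A B : ENNReal} {κ : ℝ} (hκ1 : κ < 1)
    (hB : B ≠ ⊤) (h : B ≤ A * B ^ κ) : B ≤ A ^ (1 / (1 - κ)) := by
  rcases eq_or_ne B 0 with h0 | h0
  · simp [h0]
  have hpos : 0 < 1 - κ := by linarith
  have h1 : B ^ (1 - κ) ≤ A := by
    calc B ^ (1 - κ) = B * B ^ (-κ) := by
          rw [sub_eq_add_neg, ENNReal.rpow_add _ _ h0 hB, ENNReal.rpow_one]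
      _ ≤ A * B ^ κ * B ^ (-κ) := mul_le_mul_left h _
      _ = A := by rw [mul_assoc, ← ENNReal.rpow_add _ _ h0 hB]; simp
  calc B = (B ^ (1 - κ)) ^ (1 / (1 - κ)) := by
        rw [← ENNReal.rpow_mul, mul_one_div_cancel hpos.ne', ENNReal.rpow_one]
    _ ≤ _ := ENNReal.rpow_le_rpow h1 (by positivity)

theorem exists_weak_sobolev {m k : ℕ} (hm : 1 ≤ m) (hN : 3 ≤ m + k) {γ : ℝ} (hγ : 0 ≤ γ)
    {M : ENNReal} (hM : M ≠ ⊤) :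
    ∃ B : ENNReal, B ≠ ⊤ ∧ ∀ u : Em m × Em k → ℝ, ContDiff ℝ (⊤ : ℕ∞) u → HasCompactSupport u →
      (∫⁻ z, ENNReal.ofReal (grushinSq γ u z)) ≤ M →
      ∀ t : ℝ, 0 < t → ENNReal.ofReal (t ^ twoStar m k γ) * volume {z | t ≤ |u z|} ≤ B := by
  obtain ⟨C, hC⟩ := exists_measure_superlevel_two_mul_le (k := k) (γ := γ) hm (by omega) hγ
  set D : ℝ := (m : ℝ) + (γ + 1) * k with hD
  set q : ℝ := twoStar m k γ with hq_def
  have hD2 : 2 < D := by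
    have hN' : (3 : ℝ) ≤ (m : ℝ) + k := by exact_mod_cast hN
    have : 0 ≤ γ * k := by positivity
    rw [hD]; linarith
  have hqD : q = 2 * D / (D - 2) := rfl
  have hq : 0 < q := by rw [hqD]; exact div_pos (by linarith) (by linarith)
  set s : ℝ := D / (D - 1) with hs_def
  have hs : 0 < s := div_pos (by linarith) (by linarith)
  have hs2 : s / 2 < 1 := by
    rw [hs_def, div_div, div_lt_one (by linarith)]; linarith
  have hqs : q - s = q * s / 2 := by
    rw [hqD, hs_def]
    have : D - 1 ≠ 0 := by linarith
    have : D - 2 ≠ 0 := by linarith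
    field_simp
    ring
  set A : ENNReal := ENNReal.ofReal (2 ^ q) * C * M ^ (s / 2) with hA_def
  have hA : A ≠ ⊤ := ENNReal.mul_ne_top (ENNReal.mul_ne_top ENNReal.ofReal_ne_top
    ENNReal.coe_ne_top) (ENNReal.rpow_ne_top_of_nonneg (by positivity) hM)
  refine ⟨A ^ (1 / (1 - s / 2)), ENNReal.rpow_ne_top_of_nonneg
    (one_div_nonneg.2 (by linarith)) hA, fun u hu hc hE => ?_⟩
  set F : ℝ → ENNReal := fun t => ENNReal.ofReal (t ^ q) * volume {z | t ≤ |u z|} with hF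
  set B : ENNReal := ⨆ t : Set.Ioi (0 : ℝ), F t with hB_def
  have hFB : ∀ t, 0 < t → F t ≤ B := fun t ht => le_iSup (fun t : Set.Ioi (0 : ℝ) => F t) ⟨t, ht⟩
  have hBfin : B ≠ ⊤ := by
    obtain ⟨L, hL⟩ := hc.exists_bound_of_continuous hu.continuous
    have hb : B ≤ ENNReal.ofReal (L ^ q) * volume (tsupport u) := by
      refine iSup_le fun ⟨t, ht⟩ => ?_
      have ht : 0 < t := ht
      rcases le_or_gt t L with htL | htL
      · refine mul_le_mul' (ENNReal.ofReal_le_ofReal (Real.rpow_le_rpow ht.le htL hq.le))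
          (measure_mono fun z hz => subset_tsupport u ?_)
        have hz : t ≤ |u z| := hz
        exact abs_pos.1 (ht.trans_le hz)
      · have : {z | t ≤ |u z|} = ∅ := by
          ext z
          simpa using (hL z).trans_lt htL
        simp [hF, this]
    exact ne_top_of_le_ne_top
      (ENNReal.mul_ne_top ENNReal.ofReal_ne_top hc.isCompact.measure_lt_top.ne) hb
  have hrec : ∀ t, 0 < t → F (2 * t) ≤ A * B ^ (s / 2) := by
    intro t ht
    set E := ∫⁻ z, ENNReal.ofReal (grushinSq γ u z)
    set μ := volume {z | t ≤ |u z|} with hμ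
    have hpow : ENNReal.ofReal (t ^ q) * ENNReal.ofReal t⁻¹ ^ s =
        ENNReal.ofReal (t ^ q) ^ (s / 2) := by
      rw [ENNReal.ofReal_rpow_of_pos (inv_pos.2 ht), ENNReal.ofReal_rpow_of_pos (by positivity),
        ← ENNReal.ofReal_mul (by positivity), Real.inv_rpow ht.le, ← Real.rpow_neg ht.le,
        ← Real.rpow_add ht, ← sub_eq_add_neg, hqs, ← Real.rpow_mul ht.le, mul_div_assoc]
    calc F (2 * t) ≤ ENNReal.ofReal ((2 * t) ^ q) *
          (C * (ENNReal.ofReal t⁻¹ * (E ^ ((1 : ℝ) / 2) * μ ^ ((1 : ℝ) / 2))) ^ s) :=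
          mul_le_mul_right (hC u hu hc t ht) _
      _ = ENNReal.ofReal (2 ^ q) * C * E ^ (s / 2) *
          ((ENNReal.ofReal (t ^ q) * ENNReal.ofReal t⁻¹ ^ s) * μ ^ (s / 2)) := by
          rw [Real.mul_rpow (by norm_num) ht.le, ENNReal.ofReal_mul (by positivity),
            ENNReal.mul_rpow_of_nonneg _ _ hs.le, ENNReal.mul_rpow_of_nonneg _ _ hs.le,
            ← ENNReal.rpow_mul, ← ENNReal.rpow_mul, one_div_mul_eq_div]
          ring
      _ = ENNReal.ofReal (2 ^ q) * C * E ^ (s / 2) * F t ^ (s / 2) := by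
          rw [hpow, ← ENNReal.mul_rpow_of_nonneg _ _ (by positivity)]
      _ ≤ A * B ^ (s / 2) := by
          refine mul_le_mul' (mul_le_mul_right (ENNReal.rpow_le_rpow hE (by positivity)) _)
            (ENNReal.rpow_le_rpow (hFB t ht) (by positivity))
  have hBle : B ≤ A * B ^ (s / 2) := iSup_le fun ⟨t, ht⟩ => by
    have ht : 0 < t := ht
    have := hrec (t / 2) (by positivity)
    rwa [mul_div_cancel₀ t two_ne_zero] at this
  exact fun t ht => (hFB t ht).trans (ENNReal.le_rpow_of_le_mul_rpow hs2 hBfin hBle)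

theorem exists_lintegral_rpow_superlevel_le {p q : ℝ} (hp : 0 ≤ p) (hpq : p < q) {B : ENNReal}
    (hB : B ≠ ⊤) :
    ∃ L : ENNReal, L ≠ ⊤ ∧ ∀ {α : Type*} [MeasurableSpace α] (μ : Measure α) (u : α → ℝ),
      Measurable u → (∀ t : ℝ, 0 < t → ENNReal.ofReal (t ^ q) * μ {z | t ≤ |u z|} ≤ B) →
      ∫⁻ z in {z | 1 ≤ |u z|}, ENNReal.ofReal (|u z| ^ p) ∂μ ≤ L := by
  set r : ENNReal := ENNReal.ofReal (2 ^ (p - q)) with hr_def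
  have hr : r < 1 := by
    rw [hr_def, ENNReal.ofReal_lt_one]
    exact Real.rpow_lt_one_of_one_lt_of_neg (by norm_num) (by linarith)
  refine ⟨ENNReal.ofReal (2 ^ p) * B * (1 - r)⁻¹, ENNReal.mul_ne_top
    (ENNReal.mul_ne_top ENNReal.ofReal_ne_top hB)
    (ENNReal.inv_ne_top.2 (tsub_pos_of_lt hr).ne'), fun {α} _ μ u hu h => ?_⟩
  have hA : ∀ t : ℝ, MeasurableSet {z | t ≤ |u z|} := fun t =>
    measurableSet_le measurable_const hu.norm
  have hpt : ∀ z, {z | 1 ≤ |u z|}.indicator (fun z => ENNReal.ofReal (|u z| ^ p)) z ≤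
      ∑' j : ℕ, ENNReal.ofReal (((2 : ℝ) ^ (j + 1)) ^ p) *
        {z | (2 : ℝ) ^ j ≤ |u z|}.indicator 1 z := by
    intro z
    by_cases hz : 1 ≤ |u z|
    · obtain ⟨j, hj1, hj2⟩ := exists_nat_pow_near hz (one_lt_two (α := ℝ))
      refine le_trans ?_ (ENNReal.le_tsum j)
      have hz1 : z ∈ {z | 1 ≤ |u z|} := hz
      have hz2 : z ∈ {z | (2 : ℝ) ^ j ≤ |u z|} := hj1
      rw [Set.indicator_of_mem hz1, Set.indicator_of_mem hz2, Pi.one_apply, mul_one]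
      exact ENNReal.ofReal_le_ofReal (Real.rpow_le_rpow (abs_nonneg _) hj2.le hp)
    · rw [Set.indicator_of_notMem (by exact hz)]
      exact zero_le
  rw [← lintegral_indicator (hA 1)]
  refine (lintegral_mono hpt).trans ?_
  rw [lintegral_tsum fun j =>
    ((measurable_one.indicator (hA _)).const_mul _).aemeasurable]
  rw [← ENNReal.tsum_geometric, ← ENNReal.tsum_mul_left]
  refine ENNReal.tsum_le_tsum fun j => ?_
  rw [lintegral_const_mul _ (measurable_one.indicator (hA _)), lintegral_indicator_one (hA _)]
  have h2 : ((2 : ℝ) ^ (j + 1)) ^ p = 2 ^ p * (2 ^ (p - q)) ^ j * ((2 : ℝ) ^ j) ^ q := by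
    rw [← Real.rpow_natCast, ← Real.rpow_natCast, ← Real.rpow_natCast, ← Real.rpow_mul (by simp),
      ← Real.rpow_mul (by simp), ← Real.rpow_mul (by simp), ← Real.rpow_add (by simp),
      ← Real.rpow_add (by simp)]
    congr 1
    push_cast
    ring
  rw [h2, ENNReal.ofReal_mul (by positivity), ENNReal.ofReal_mul (by positivity),
    ENNReal.ofReal_pow (by positivity)]
  calc ENNReal.ofReal (2 ^ p) * r ^ j * ENNReal.ofReal (((2 : ℝ) ^ j) ^ q) *
        μ {z | (2 : ℝ) ^ j ≤ |u z|}
      = ENNReal.ofReal (2 ^ p) * r ^ j * (ENNReal.ofReal (((2 : ℝ) ^ j) ^ q) *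
        μ {z | (2 : ℝ) ^ j ≤ |u z|}) := by rw [mul_assoc]
    _ ≤ ENNReal.ofReal (2 ^ p) * r ^ j * B := mul_le_mul_right (h _ (by positivity)) _
    _ = ENNReal.ofReal (2 ^ p) * B * r ^ j := by ring

/-- Tail estimate for the weighted integral. -/
theorem lintegral_weight_le {m k : ℕ} {Q u : Em m × Em k → ℝ} (hu : Continuous u)
    {C_Q α β p R : ℝ} (hCQ : 0 < C_Q) (hα : 0 < α) (hαβ : α < β) (hp : 2 ≤ p) (hR : 0 < R)
    (hQ : ∀ᵐ z ∂(volume : Measure (Em m × Em k)), 0 < Q z ∧ Q z ≤ C_Q / (1 + pnorm z) ^ β) :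
    ∫⁻ z, ENNReal.ofReal (Q z * |u z| ^ p) ≤
      ENNReal.ofReal C_Q * (∫⁻ z in pball m k R, ENNReal.ofReal (|u z| ^ p)) +
      ENNReal.ofReal (C_Q * R ^ (-(β - α))) *
        ((∫⁻ z, ENNReal.ofReal (u z ^ 2 / (1 + pnorm z) ^ α)) +
          ∫⁻ z in {z | 1 ≤ |u z|}, ENNReal.ofReal (|u z| ^ p)) := by
  have hpn : Continuous (pnorm : Em m × Em k → ℝ) := by unfold pnorm; fun_prop
  have hball : MeasurableSet (pball m k R) := measurableSet_lt hpn.measurable measurable_const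
  have hA : MeasurableSet {z | 1 ≤ |u z|} := measurableSet_le measurable_const hu.abs.measurable
  have hum := hu.measurable
  have hpm := hpn.measurable
  have hup : Measurable fun z => ENNReal.ofReal (|u z| ^ p) := by fun_prop
  have huα : Measurable fun z => ENNReal.ofReal (u z ^ 2 / (1 + pnorm z) ^ α) := by fun_prop
  rw [← lintegral_indicator hball, ← lintegral_indicator hA, ← lintegral_add_left huα,
    ← lintegral_const_mul' _ _ ENNReal.ofReal_ne_top,
    ← lintegral_const_mul' _ _ ENNReal.ofReal_ne_top,
    ← lintegral_add_left ((hup.indicator hball).const_mul _)]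
  refine lintegral_mono_ae ?_
  filter_upwards [hQ] with z hz
  have hn : 0 ≤ pnorm z := Real.sqrt_nonneg _
  have h1 : 1 ≤ 1 + pnorm z := by linarith
  have hupz : 0 ≤ |u z| ^ p := Real.rpow_nonneg (abs_nonneg _) _
  by_cases hzR : z ∈ pball m k R
  · rw [Set.indicator_of_mem hzR]
    refine le_trans ?_ le_self_add
    rw [← ENNReal.ofReal_mul hCQ.le]
    refine ENNReal.ofReal_le_ofReal (mul_le_mul_of_nonneg_right ?_ hupz)
    exact hz.2.trans (div_le_self hCQ.le (Real.one_le_rpow h1 (by linarith)))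
  · rw [Set.indicator_of_notMem hzR, mul_zero, zero_add]
    have hRz : R ≤ 1 + pnorm z := by
      have : R ≤ pnorm z := by simpa [pball] using hzR
      linarith
    set w := (1 + pnorm z) ^ α with hw_def
    have hw : 1 ≤ w := Real.one_le_rpow h1 hα.le
    have hQz : Q z ≤ C_Q * R ^ (-(β - α)) * (1 / w) := by
      refine hz.2.trans ?_
      have : (1 + pnorm z) ^ β = (1 + pnorm z) ^ (β - α) * w := by
        rw [hw_def, ← Real.rpow_add (by linarith)]; ring_nf
      rw [this, ← div_div, Real.rpow_neg hR.le, ← div_eq_mul_inv, div_eq_mul_one_div _ w]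
      have hRp : R ^ (β - α) ≤ (1 + pnorm z) ^ (β - α) :=
        Real.rpow_le_rpow hR.le hRz (by linarith)
      gcongr
    have hRβ : 0 ≤ C_Q * R ^ (-(β - α)) := by positivity
    rcases le_or_gt 1 |u z| with hu1 | hu1
    · have hz1 : z ∈ {z | 1 ≤ |u z|} := hu1
      rw [Set.indicator_of_mem hz1]
      calc ENNReal.ofReal (Q z * |u z| ^ p)
          ≤ ENNReal.ofReal (C_Q * R ^ (-(β - α)) * |u z| ^ p) := by
            refine ENNReal.ofReal_le_ofReal (mul_le_mul_of_nonneg_right ?_ hupz)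
            refine hQz.trans (mul_le_of_le_one_right hRβ ?_)
            rw [div_le_one (by linarith)]
            exact hw
        _ = ENNReal.ofReal (C_Q * R ^ (-(β - α))) * ENNReal.ofReal (|u z| ^ p) :=
            ENNReal.ofReal_mul hRβ
        _ ≤ _ := mul_le_mul_right le_add_self _
    · calc ENNReal.ofReal (Q z * |u z| ^ p)
          ≤ ENNReal.ofReal (C_Q * R ^ (-(β - α)) * (u z ^ 2 / w)) := by
            refine ENNReal.ofReal_le_ofReal ?_
            have h2 : |u z| ^ p ≤ u z ^ 2 := by
              rw [← sq_abs, ← Real.rpow_natCast]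
              exact Real.rpow_le_rpow_of_exponent_ge' (abs_nonneg _) hu1.le (by norm_num)
                (by exact_mod_cast hp)
            calc Q z * |u z| ^ p ≤ C_Q * R ^ (-(β - α)) * (1 / w) * u z ^ 2 :=
                  mul_le_mul hQz h2 hupz (by positivity)
              _ = C_Q * R ^ (-(β - α)) * (u z ^ 2 / w) := by ring
        _ = ENNReal.ofReal (C_Q * R ^ (-(β - α))) * ENNReal.ofReal (u z ^ 2 / w) :=
            ENNReal.ofReal_mul hRβ
        _ ≤ _ := mul_le_mul_right le_self_add _

/-- Compactness core, case (ii'): under (V), (Q) with `N < α ≤ β`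
and `2 ≤ p < p̄ = min{2(β-N)/(α-N), 2*_γ}`, if `(u_n) ⊂ C_c^∞` is bounded in `E_V^γ`
and `∫_{B_R} |u_n|^p → 0` for every `R > 0`, then `∫ Q|u_n|^p → 0`. -/
theorem compactness_case_ii (m k : ℕ) (hm : 1 ≤ m) (hk : 1 ≤ k) (hN : 3 ≤ m + k)
    (γ : ℝ) (hγ : 0 < γ)
    (V Q : Em m × Em k → ℝ) (hVmeas : Measurable V) (hQmeas : Measurable Q)
    (C_V C_Q α β : ℝ) (hCV : 0 < C_V) (hCQ : 0 < C_Q)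
    (hV : ∀ᵐ z ∂(volume : Measure (Em m × Em k)), C_V / (1 + pnorm z) ^ α ≤ V z)
    (hQ : ∀ᵐ z ∂(volume : Measure (Em m × Em k)), 0 < Q z ∧ Q z ≤ C_Q / (1 + pnorm z) ^ β)
    (hα : ((m : ℝ) + k) < α) (hαβ : α ≤ β)
    (p : ℝ) (hp1 : 2 ≤ p)
    (hp2 : p < min (2 * (β - ((m : ℝ) + k)) / (α - ((m : ℝ) + k))) (twoStar m k γ))
    (u : ℕ → Em m × Em k → ℝ)
    (husm : ∀ n, ContDiff ℝ (⊤ : ℕ∞) (u n)) (hucpt : ∀ n, HasCompactSupport (u n))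
    (hbd : ∃ M : ℝ, ∀ n,
      (∫⁻ z, ENNReal.ofReal (grushinSq γ (u n) z + V z * u n z ^ 2)) ≤ ENNReal.ofReal M)
    (hloc : ∀ R : ℝ, 0 < R →
      Filter.Tendsto (fun n => ∫ z in pball m k R, |u n z| ^ p) Filter.atTop (nhds 0)) :
    Filter.Tendsto (fun n => ∫ z, Q z * |u n z| ^ p) Filter.atTop (nhds 0) := by
  obtain ⟨M, hM⟩ := hbd
  have hN0 : 0 < (m : ℝ) + k := by
    have : (1 : ℝ) ≤ m := by exact_mod_cast hm
    positivity
  have hα0 : 0 < α := hN0.trans hα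
  have hαN : 0 < α - ((m : ℝ) + k) := sub_pos.2 hα
  have hαβ' : α < β := by
    have h := hp1.trans_lt (hp2.trans_le (min_le_left _ _))
    rw [lt_div_iff₀ hαN] at h
    linarith
  obtain ⟨B, hB, hBu⟩ := exists_weak_sobolev hm hN hγ.le (M := ENNReal.ofReal M)
    ENNReal.ofReal_ne_top
  obtain ⟨L, hL, hLu⟩ := exists_lintegral_rpow_superlevel_le (p := p) (by linarith)
    (hp2.trans_le (min_le_right _ _)) hB
  have hVnn : ∀ᵐ z ∂(volume : Measure (Em m × Em k)), 0 ≤ V z := by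
    filter_upwards [hV] with z hz
    have : 0 ≤ pnorm z := Real.sqrt_nonneg _
    exact le_trans (by positivity) hz
  have hsq : ∀ n z, 0 ≤ grushinSq γ (u n) z := fun n z => by unfold grushinSq; positivity
  have hE : ∀ n, ∫⁻ z, ENNReal.ofReal (grushinSq γ (u n) z) ≤ ENNReal.ofReal M := fun n => by
    refine (lintegral_mono_ae ?_).trans (hM n)
    filter_upwards [hVnn] with z hz
    exact ENNReal.ofReal_le_ofReal (le_add_of_nonneg_right (by positivity))
  have hW : ∀ n, ∫⁻ z, ENNReal.ofReal (u n z ^ 2 / (1 + pnorm z) ^ α) ≤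
      ENNReal.ofReal C_V⁻¹ * ENNReal.ofReal M := fun n => by
    refine le_trans ?_ (mul_le_mul_right (hM n) _)
    rw [← lintegral_const_mul' _ _ ENNReal.ofReal_ne_top]
    refine lintegral_mono_ae ?_
    filter_upwards [hV] with z hz
    rw [← ENNReal.ofReal_mul (inv_pos.2 hCV).le]
    refine ENNReal.ofReal_le_ofReal ?_
    rw [inv_mul_eq_div, le_div_iff₀ hCV]
    calc u n z ^ 2 / (1 + pnorm z) ^ α * C_V = C_V / (1 + pnorm z) ^ α * u n z ^ 2 := by ring
      _ ≤ V z * u n z ^ 2 := mul_le_mul_of_nonneg_right hz (sq_nonneg _)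
      _ ≤ _ := le_add_of_nonneg_left (hsq n z)
  set T : ENNReal := ENNReal.ofReal C_V⁻¹ * ENNReal.ofReal M + L with hT
  have hTfin : T ≠ ⊤ :=
    ENNReal.add_ne_top.2 ⟨ENNReal.mul_ne_top ENNReal.ofReal_ne_top ENNReal.ofReal_ne_top, hL⟩
  have hball : ∀ R, ∀ n, ∫⁻ z in pball m k R, ENNReal.ofReal (|u n z| ^ p) =
      ENNReal.ofReal (∫ z in pball m k R, |u n z| ^ p) := fun R n => by
    have hcont : Continuous fun z => |u n z| ^ p :=
      (husm n).continuous.abs.rpow_const fun _ => Or.inr (by linarith)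
    have hcs : HasCompactSupport fun z => |u n z| ^ p :=
      (hucpt n).comp_left (g := fun y : ℝ => |y| ^ p)
        (by rw [abs_zero, Real.zero_rpow (by linarith)])
    exact (ofReal_integral_eq_lintegral_ofReal (hcont.integrable_of_hasCompactSupport
      hcs).integrableOn (ae_of_all _ fun z => by positivity)).symm
  have hmain : ∀ R, 0 < R → ∀ n, ∫⁻ z, ENNReal.ofReal (Q z * |u n z| ^ p) ≤
      ENNReal.ofReal (C_Q * (∫ z in pball m k R, |u n z| ^ p) +
        C_Q * R ^ (-(β - α)) * T.toReal) := fun R hR n => by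
    have hI : 0 ≤ ∫ z in pball m k R, |u n z| ^ p := integral_nonneg fun z => by positivity
    refine (lintegral_weight_le (husm n).continuous hCQ hα0 hαβ' hp1 hR hQ).trans ?_
    rw [hball, ENNReal.ofReal_add (by positivity) (by positivity),
      ENNReal.ofReal_mul (q := ∫ z in pball m k R, |u n z| ^ p) hCQ.le,
      ENNReal.ofReal_mul (p := C_Q * R ^ (-(β - α))) (by positivity), ENNReal.ofReal_toReal hTfin]
    exact add_le_add le_rfl (mul_le_mul_right (add_le_add (hW n)
      (hLu volume (u n) (husm n).continuous.measurable
        (hBu (u n) (husm n) (hucpt n) (hE n)))) _)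
  have hreal : ∀ R, 0 < R → ∀ n, ∫ z, Q z * |u n z| ^ p ≤
      C_Q * (∫ z in pball m k R, |u n z| ^ p) + C_Q * R ^ (-(β - α)) * T.toReal :=
    fun R hR n => by
    have hI : 0 ≤ ∫ z in pball m k R, |u n z| ^ p := integral_nonneg fun z => by positivity
    have hum := (husm n).continuous.measurable
    rw [integral_eq_lintegral_of_nonneg_ae]
    · exact ENNReal.toReal_le_of_le_ofReal (by positivity) (hmain R hR n)
    · filter_upwards [hQ] with z hz
      exact mul_nonneg hz.1.le (by positivity)
    · exact (hQmeas.mul (by fun_prop)).aestronglyMeasurable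
  have hnn : ∀ n, 0 ≤ ∫ z, Q z * |u n z| ^ p := fun n => by
    refine integral_nonneg_of_ae ?_
    filter_upwards [hQ] with z hz
    exact mul_nonneg hz.1.le (by positivity)
  have htail : Tendsto (fun R : ℝ => C_Q * R ^ (-(β - α)) * T.toReal) atTop (nhds 0) := by
    simpa using ((tendsto_rpow_neg_atTop (sub_pos.2 hαβ')).const_mul C_Q).mul_const T.toReal
  refine tendsto_order.2 ⟨fun a ha => Eventually.of_forall fun n => ha.trans_le (hnn n),
    fun ε hε => ?_⟩
  obtain ⟨R, hRε, hR⟩ :=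
    ((htail.eventually_lt_const (half_pos hε)).and (eventually_gt_atTop 0)).exists
  have hnear : Tendsto (fun n => C_Q * ∫ z in pball m k R, |u n z| ^ p) atTop (nhds 0) := by
    simpa using (hloc R hR).const_mul C_Q
  filter_upwards [hnear.eventually_lt_const (half_pos hε)] with n hn
  linarith [hreal R hR n]
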